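/- (i) A legal abstract path has weight 2 if and only if it has the form Ia or Ib; that is, either it consists of exactly two interior edges joined by a single (interior) break, or it consists of a single boundary node together with its adjacent interior nodes (coinciding with the interior star of that boundary node) and the boundary node satisfies the condition of Move Ib. (ii) A boundary abstract path has length 2 if and only if it consists of two boundary edges joined by a single break (the configuration of Move II). -/

import Mathlib

/-!
Statement 7: (i) A legal abstract path has weight 2 iff it has the form Ia or Ib.
(ii) A boundary abstract path has length 2 iff it consists of two boundary edges joined by a
single break.
-/

open scoped Classical

noncomputable section

/-- The three types of abstract vertices: interior, unstable, stable. -/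
inductive VType : Type
  | o | u | s
deriving DecidableEq

/-- An abstract edge: an element of 𝔽₂ × ℕ³ × ℕ³, recording whether the edge is interior
(μ = 0) or boundary (μ = 1), and the numbers of incoming and outgoing ends of each type. -/
structure AbsEdge where
  mu : ZMod 2
  o1 : ℕ
  u1 : ℕ
  s1 : ℕ
  o2 : ℕ
  u2 : ℕ
  s2 : ℕ

/-- The defining conditions of an abstract edge: interior edges have `s₁ = u₂ = 0` and
boundary edges have `o₁ = o₂ = 0`. -/
def AbsEdge.IsValid (ε : AbsEdge) : Prop :=
  (ε.mu = 0 → ε.s1 = 0 ∧ ε.u2 = 0) ∧ (ε.mu = 1 → ε.o1 = 0 ∧ ε.o2 = 0)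

/-- Raw combinatorial data of an abstract path: a finite node set, an arrow set, a labeling
`τ` of nodes by abstract edges and a labeling `σ` of arrows by vertex types. -/
structure RawAbs where
  nodes : Finset ℕ
  arrows : Finset (ℕ × ℕ)
  lab : ℕ → AbsEdge
  brk : ℕ × ℕ → VType

/-- The underlying undirected simple graph of the arrow set, on the node set. -/
def RawAbs.graph (r : RawAbs) : SimpleGraph {x // x ∈ r.nodes} :=
  SimpleGraph.fromRel (fun a b => ((a : ℕ), (b : ℕ)) ∈ r.arrows)

/-- The underlying data forms a (finite) non-empty directed tree. -/
def RawAbs.IsDirTree (r : RawAbs) : Prop :=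
  r.nodes.Nonempty ∧
  (∀ e ∈ r.arrows, e.1 ∈ r.nodes ∧ e.2 ∈ r.nodes ∧ e.1 ≠ e.2) ∧
  (∀ a b : ℕ, (a, b) ∈ r.arrows → (b, a) ∉ r.arrows) ∧
  r.graph.IsTree

/-- The number of incoming arrows at `v` labeled `t`. -/
def inDeg (r : RawAbs) (v : ℕ) (t : VType) : ℕ :=
  (r.arrows.filter fun e => e.2 = v ∧ r.brk e = t).card

/-- The number of outgoing arrows at `v` labeled `t`. -/
def outDeg (r : RawAbs) (v : ℕ) (t : VType) : ℕ :=
  (r.arrows.filter fun e => e.1 = v ∧ r.brk e = t).card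

/-- The total number of incoming arrows at `v`. -/
def inDegAll (r : RawAbs) (v : ℕ) : ℕ := (r.arrows.filter fun e => e.2 = v).card

/-- The total number of outgoing arrows at `v`. -/
def outDegAll (r : RawAbs) (v : ℕ) : ℕ := (r.arrows.filter fun e => e.1 = v).card

/-- `r` is an abstract path: the underlying data is a non-empty directed tree, the node labels
are abstract edges, and at every node the numbers of ends of each type dominate the numbers of
incident arrows of that type. -/
def IsAbsPath (r : RawAbs) : Prop :=
  r.IsDirTree ∧
  (∀ v ∈ r.nodes, (r.lab v).IsValid) ∧
  (∀ v ∈ r.nodes,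
    inDeg r v .o ≤ (r.lab v).o1 ∧ inDeg r v .u ≤ (r.lab v).u1 ∧
    inDeg r v .s ≤ (r.lab v).s1 ∧ outDeg r v .o ≤ (r.lab v).o2 ∧
    outDeg r v .u ≤ (r.lab v).u2 ∧ outDeg r v .s ≤ (r.lab v).s2)

/-- The weight of an abstract edge: `1` if interior, `2 − s₁ − u₂` if boundary. -/
def AbsEdge.w (ε : AbsEdge) : ℤ := if ε.mu = 0 then 1 else 2 - (ε.s1 : ℤ) - (ε.u2 : ℤ)

/-- The weight of an abstract path: the sum of the weights of its edges. -/
def weight (r : RawAbs) : ℤ := ∑ v ∈ r.nodes, (r.lab v).w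

/-- `O(τ)`: the number of interior breaks. -/
def Ocnt (r : RawAbs) : ℕ := (r.arrows.filter fun e => r.brk e = .o).card

/-- `U(τ)`: the number of unstable breaks. -/
def Ucnt (r : RawAbs) : ℕ := (r.arrows.filter fun e => r.brk e = .u).card

/-- `S(τ)`: the number of stable breaks. -/
def Scnt (r : RawAbs) : ℕ := (r.arrows.filter fun e => r.brk e = .s).card

/-- `B(τ)`: the number of boundary edges. -/
def Bcnt (r : RawAbs) : ℕ := (r.nodes.filter fun v => (r.lab v).mu = 1).card

/-- `s₁(τ) = Σ_v s₁(v) − #σ⁻¹(s)`: the number of free incoming stable ends. -/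
def s1tot (r : RawAbs) : ℤ := (∑ v ∈ r.nodes, ((r.lab v).s1 : ℤ)) - Scnt r

/-- `s₂(τ) = Σ_v s₂(v) − #σ⁻¹(s)`: the number of free outgoing stable ends. -/
def s2tot (r : RawAbs) : ℤ := (∑ v ∈ r.nodes, ((r.lab v).s2 : ℤ)) - Scnt r

/-- `u₂(τ) = Σ_v u₂(v) − #σ⁻¹(u)`: the number of free outgoing unstable ends. -/
def u2tot (r : RawAbs) : ℤ := (∑ v ∈ r.nodes, ((r.lab v).u2 : ℤ)) - Ucnt r

/-- An abstract path is legal if `s₁(τ) = u₂(τ) = 0`. -/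
def Legal (r : RawAbs) : Prop := s1tot r = 0 ∧ u2tot r = 0

/-- The interior neighborhood of a node: the set of adjacent interior nodes. -/
def NbhdO (r : RawAbs) (v : ℕ) : Finset ℕ :=
  r.nodes.filter fun x => (r.lab x).mu = 0 ∧ ((x, v) ∈ r.arrows ∨ (v, x) ∈ r.arrows)

/-- Contract the set of nodes `del ∪ {v}` to the single node `v`, relabeling it by `newLab`;
the arrow labels are transported along the induced bijection on the remaining arrows. -/
def contractTo (r : RawAbs) (del : Finset ℕ) (v : ℕ) (newLab : AbsEdge) : RawAbs :=
  let m : ℕ → ℕ := fun x => if x ∈ del then v else x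
  { nodes := r.nodes \ del
    arrows := (r.arrows.filter fun e => ¬(m e.1 = v ∧ m e.2 = v)).image
      fun e => (m e.1, m e.2)
    lab := fun x => if x = v then newLab else r.lab x
    brk := fun p =>
      if h : ∃ e ∈ r.arrows.filter fun e => ¬(m e.1 = v ∧ m e.2 = v),
          (m e.1, m e.2) = p then r.brk h.choose
      else r.brk p }

/-- The label `τ(s(e)) + τ(t(e)) − (0,(1,0,0),(1,0,0))` of the node produced by Move Ia. -/
def labIa (ε₁ ε₂ : AbsEdge) : AbsEdge :=
  ⟨ε₁.mu + ε₂.mu, ε₁.o1 + ε₂.o1 - 1, ε₁.u1 + ε₂.u1, ε₁.s1 + ε₂.s1,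
    ε₁.o2 + ε₂.o2 - 1, ε₁.u2 + ε₂.u2, ε₁.s2 + ε₂.s2⟩

/-- The label of the node produced by Move II: subtract `(1,(0,1,0),(0,1,0))` for an unstable
break and `(1,(0,0,1),(0,0,1))` for a stable break. -/
def labII (t : VType) (ε₁ ε₂ : AbsEdge) : AbsEdge :=
  match t with
  | .u => ⟨ε₁.mu + ε₂.mu + 1, ε₁.o1 + ε₂.o1, ε₁.u1 + ε₂.u1 - 1, ε₁.s1 + ε₂.s1,
      ε₁.o2 + ε₂.o2, ε₁.u2 + ε₂.u2 - 1, ε₁.s2 + ε₂.s2⟩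
  | _ => ⟨ε₁.mu + ε₂.mu + 1, ε₁.o1 + ε₂.o1, ε₁.u1 + ε₂.u1, ε₁.s1 + ε₂.s1 - 1,
      ε₁.o2 + ε₂.o2, ε₁.u2 + ε₂.u2, ε₁.s2 + ε₂.s2 - 1⟩

/-- The label `Σ_{v' ∈ Nbhd°(v)} τ(v') − τ(v) + (1,(0,0,0),(0,0,0))` of the node produced by
Move Ib. -/
def labIb (r : RawAbs) (v : ℕ) : AbsEdge :=
  ⟨(∑ x ∈ NbhdO r v, (r.lab x).mu) + (r.lab v).mu + 1,
    (∑ x ∈ NbhdO r v, (r.lab x).o1) - (r.lab v).o1,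
    (∑ x ∈ NbhdO r v, (r.lab x).u1) - (r.lab v).u1,
    (∑ x ∈ NbhdO r v, (r.lab x).s1) - (r.lab v).s1,
    (∑ x ∈ NbhdO r v, (r.lab x).o2) - (r.lab v).o2,
    (∑ x ∈ NbhdO r v, (r.lab x).u2) - (r.lab v).u2,
    (∑ x ∈ NbhdO r v, (r.lab x).s2) - (r.lab v).s2⟩

/-- Move Ia applies at the arrow `e` if both of its endpoints are interior nodes. -/
def CanIa (r : RawAbs) (e : ℕ × ℕ) : Prop :=
  e ∈ r.arrows ∧ (r.lab e.1).mu = 0 ∧ (r.lab e.2).mu = 0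

/-- Move II applies at the arrow `e` if both of its endpoints are boundary nodes. -/
def CanII (r : RawAbs) (e : ℕ × ℕ) : Prop :=
  e ∈ r.arrows ∧ (r.lab e.1).mu = 1 ∧ (r.lab e.2).mu = 1

/-- Move Ib applies at a boundary node `v` with `o₁(v) + s₁(v)` incoming arrows and
`o₂(v) + u₂(v)` outgoing arrows. -/
def CanIb (r : RawAbs) (v : ℕ) : Prop :=
  v ∈ r.nodes ∧ (r.lab v).mu = 1 ∧
  (r.lab v).o1 + (r.lab v).s1 = inDegAll r v ∧
  (r.lab v).o2 + (r.lab v).u2 = outDegAll r v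

/-- Move Ia (interior): contract an arrow between interior nodes. -/
def glueIa (r : RawAbs) (e : ℕ × ℕ) : RawAbs :=
  contractTo r {e.2} e.1 (labIa (r.lab e.1) (r.lab e.2))

/-- Move II (boundary): contract an arrow between boundary nodes. -/
def glueII (r : RawAbs) (e : ℕ × ℕ) : RawAbs :=
  contractTo r {e.2} e.1 (labII (r.brk e) (r.lab e.1) (r.lab e.2))

/-- Move Ib (boundary-obstructed): contract the interior star of a boundary node. -/
def glueIb (r : RawAbs) (v : ℕ) : RawAbs :=
  contractTo r (NbhdO r v) v (labIb r v)


/-- The form Ia: exactly two interior edges joined by a single (interior) break. -/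
def FormIa (r : RawAbs) : Prop :=
  ∃ a b : ℕ, a ≠ b ∧ r.nodes = {a, b} ∧ r.arrows = {(a, b)} ∧
    (r.lab a).mu = 0 ∧ (r.lab b).mu = 0 ∧ r.brk (a, b) = .o

/-- The form Ib: a single boundary node together with its adjacent interior nodes (the path
coincides with the interior star of that node), the boundary node satisfying the condition of
Move Ib. -/
def FormIb (r : RawAbs) : Prop :=
  ∃ v ∈ r.nodes, (r.lab v).mu = 1 ∧ CanIb r v ∧
    ∀ x ∈ r.nodes, x ≠ v →
      (r.lab x).mu = 0 ∧ ((x, v) ∈ r.arrows ∨ (v, x) ∈ r.arrows)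

theorem AbsEdge.mu_eq_zero_or_one (ε : AbsEdge) : ε.mu = 0 ∨ ε.mu = 1 := by
  generalize ε.mu = m
  fin_cases m
  · exact Or.inl rfl
  · exact Or.inr rfl

/-- A directed tree has one more node than arrows. -/
theorem RawAbs.IsDirTree.card_arrows {r : RawAbs} (h : r.IsDirTree) :
    r.arrows.card + 1 = r.nodes.card := by
  obtain ⟨-, harr, hanti, htree⟩ := h
  have hadj : ∀ x y, r.graph.Adj x y ↔
      x ≠ y ∧ (((x : ℕ), (y : ℕ)) ∈ r.arrows ∨ ((y : ℕ), (x : ℕ)) ∈ r.arrows) :=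
    SimpleGraph.fromRel_adj _
  have hcard := htree.card_edgeFinset
  rw [Fintype.card_coe] at hcard
  rw [← hcard, ← Finset.card_attach]
  congr 1
  refine Finset.card_bij
    (fun e _ => s(⟨e.1.1, (harr _ e.2).1⟩, ⟨e.1.2, (harr _ e.2).2.1⟩)) ?_ ?_ ?_
  · intro e _
    simp only [SimpleGraph.mem_edgeFinset, SimpleGraph.mem_edgeSet, hadj]
    exact ⟨fun hh => (harr _ e.2).2.2 (congrArg Subtype.val hh), Or.inl e.2⟩
  · rintro ⟨⟨a, b⟩, he⟩ _ ⟨⟨c, d⟩, hf⟩ _ hh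
    simp only [Sym2.eq_iff, Subtype.mk.injEq] at hh
    rcases hh with ⟨rfl, rfl⟩ | ⟨rfl, rfl⟩
    · rfl
    · exact absurd hf (hanti _ _ he)
  · intro e he
    induction e using Sym2.ind with
    | _ x y =>
      simp only [SimpleGraph.mem_edgeFinset, SimpleGraph.mem_edgeSet, hadj] at he
      rcases he.2 with h1 | h1
      · exact ⟨⟨_, h1⟩, Finset.mem_attach _ _, rfl⟩
      · exact ⟨⟨_, h1⟩, Finset.mem_attach _ _, Sym2.eq_swap⟩

/-- A node of a directed tree different from another one has an incident arrow. -/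
theorem RawAbs.IsDirTree.exists_adjacent {r : RawAbs} (h : r.IsDirTree) {x v : ℕ}
    (hx : x ∈ r.nodes) (hv : v ∈ r.nodes) (hxv : x ≠ v) :
    ∃ y, (x, y) ∈ r.arrows ∨ (y, x) ∈ r.arrows := by
  obtain ⟨p⟩ := h.2.2.2.connected.preconnected ⟨x, hx⟩ ⟨v, hv⟩
  cases p with
  | nil => exact absurd rfl hxv
  | cons hadj _ =>
    simp only [RawAbs.graph, SimpleGraph.fromRel_adj] at hadj
    exact ⟨_, hadj.2⟩

/-- A directed tree with two nodes consists of a single arrow and its two endpoints. -/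
theorem RawAbs.IsDirTree.exists_eq_pair {r : RawAbs} (h : r.IsDirTree)
    (hcard : r.nodes.card = 2) :
    ∃ a b : ℕ, a ≠ b ∧ r.nodes = {a, b} ∧ r.arrows = {(a, b)} := by
  have h1 := h.card_arrows
  obtain ⟨⟨a, b⟩, he⟩ := Finset.card_eq_one.1 (show r.arrows.card = 1 by omega)
  obtain ⟨ha, hb, hab⟩ := h.2.1 (a, b) (by simp [he])
  refine ⟨a, b, hab, (Finset.eq_of_subset_of_card_le ?_ ?_).symm, he⟩
  · intro x hx
    simp only [Finset.mem_insert, Finset.mem_singleton] at hx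
    rcases hx with rfl | rfl <;> assumption
  · rw [hcard, Finset.card_pair hab]

theorem card_arrows_eq (r : RawAbs) : r.arrows.card = Ocnt r + Ucnt r + Scnt r := by
  simp only [Ocnt, Ucnt, Scnt, Finset.card_filter, ← Finset.sum_add_distrib]
  rw [Finset.card_eq_sum_ones]
  refine Finset.sum_congr rfl fun e _ => ?_
  cases r.brk e <;> simp

theorem weight_eq {r : RawAbs} (hval : ∀ v ∈ r.nodes, (r.lab v).IsValid) :
    weight r = r.nodes.card + Bcnt r - ∑ v ∈ r.nodes, ((r.lab v).s1 : ℤ)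
      - ∑ v ∈ r.nodes, ((r.lab v).u2 : ℤ) := by
  have hN : (r.nodes.card : ℤ) = ∑ v ∈ r.nodes, 1 := by simp
  have hB : (Bcnt r : ℤ) = ∑ v ∈ r.nodes, if (r.lab v).mu = 1 then 1 else 0 := by simp [Bcnt]
  rw [weight, hN, hB, ← Finset.sum_add_distrib, ← Finset.sum_sub_distrib,
    ← Finset.sum_sub_distrib]
  refine Finset.sum_congr rfl fun v hv => ?_
  rcases (r.lab v).mu_eq_zero_or_one with h0 | h1
  · obtain ⟨hs, hu⟩ := (hval v hv).1 h0
    simp [AbsEdge.w, h0, hs, hu]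
  · simp [AbsEdge.w, h1]

/-- The weight of a legal abstract path is one more than the number of interior breaks plus the
number of boundary edges. -/
theorem Legal.weight_eq {r : RawAbs} (hl : Legal r) (h : IsAbsPath r) :
    weight r = 1 + Ocnt r + Bcnt r := by
  have h1 := h.1.card_arrows
  have h2 := card_arrows_eq r
  have h3 := _root_.weight_eq h.2.1
  obtain ⟨hs, hu⟩ := hl
  unfold s1tot at hs
  unfold u2tot at hu
  omega

theorem IsAbsPath.s1_pos {r : RawAbs} (h : IsAbsPath r) {e : ℕ × ℕ} (he : e ∈ r.arrows)
    (hb : r.brk e = .s) : 0 < (r.lab e.2).s1 :=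
  (Finset.card_pos.2 ⟨e, by simp [he, hb]⟩).trans_le (h.2.2 e.2 (h.1.2.1 e he).2.1).2.2.1

theorem IsAbsPath.u2_pos {r : RawAbs} (h : IsAbsPath r) {e : ℕ × ℕ} (he : e ∈ r.arrows)
    (hb : r.brk e = .u) : 0 < (r.lab e.1).u2 :=
  (Finset.card_pos.2 ⟨e, by simp [he, hb]⟩).trans_le
    (h.2.2 e.1 (h.1.2.1 e he).1).2.2.2.2.1

theorem IsAbsPath.mu_target {r : RawAbs} (h : IsAbsPath r) {e : ℕ × ℕ} (he : e ∈ r.arrows)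
    (hb : r.brk e = .s) : (r.lab e.2).mu = 1 :=
  (AbsEdge.mu_eq_zero_or_one _).resolve_left fun h0 =>
    (h.s1_pos he hb).ne' ((h.2.1 _ (h.1.2.1 e he).2.1).1 h0).1

theorem IsAbsPath.mu_source {r : RawAbs} (h : IsAbsPath r) {e : ℕ × ℕ} (he : e ∈ r.arrows)
    (hb : r.brk e = .u) : (r.lab e.1).mu = 1 :=
  (AbsEdge.mu_eq_zero_or_one _).resolve_left fun h0 =>
    (h.u2_pos he hb).ne' ((h.2.1 _ (h.1.2.1 e he).1).1 h0).2

theorem IsAbsPath.formIa {r : RawAbs} (h : IsAbsPath r) (hO : Ocnt r = 1) (hB : Bcnt r = 0) :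
    FormIa r := by
  have hint : ∀ v ∈ r.nodes, (r.lab v).mu ≠ 1 := by
    intro v hv h1
    exact Finset.filter_eq_empty_iff.1 (Finset.card_eq_zero.1 hB) hv h1
  have hint0 : ∀ v ∈ r.nodes, (r.lab v).mu = 0 := fun v hv =>
    (AbsEdge.mu_eq_zero_or_one _).resolve_right (hint v hv)
  have hbrk : ∀ e ∈ r.arrows, r.brk e = .o := by
    intro e he
    cases hb : r.brk e with
    | o => rfl
    | u => exact absurd (h.mu_source he hb) (hint _ (h.1.2.1 e he).1)
    | s => exact absurd (h.mu_target he hb) (hint _ (h.1.2.1 e he).2.1)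
  have hcard : r.arrows.card = 1 := by
    rw [← hO, Ocnt, Finset.filter_true_of_mem hbrk]
  obtain ⟨a, b, hab, hn, ha⟩ := h.1.exists_eq_pair (by have := h.1.card_arrows; omega)
  exact ⟨a, b, hab, hn, ha, hint0 a (by simp [hn]), hint0 b (by simp [hn]),
    hbrk _ (by simp [ha])⟩

theorem IsAbsPath.formIb {r : RawAbs} (h : IsAbsPath r) (hl : Legal r) (hO : Ocnt r = 0)
    (hB : Bcnt r = 1) : FormIb r := by
  obtain ⟨v, hv⟩ := Finset.card_eq_one.1 hB
  have hiff : ∀ x, x ∈ r.nodes ∧ (r.lab x).mu = 1 ↔ x = v := by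
    intro x
    rw [← Finset.mem_singleton (a := v), ← hv, Finset.mem_filter]
  obtain ⟨hvn, hv1⟩ := (hiff v).2 rfl
  have hint : ∀ x ∈ r.nodes, x ≠ v → (r.lab x).mu = 0 := fun x hx hxv =>
    (AbsEdge.mu_eq_zero_or_one _).resolve_right fun h1 => hxv ((hiff x).1 ⟨hx, h1⟩)
  have hbrk : ∀ e ∈ r.arrows, (r.brk e = .s ∧ e.2 = v) ∨ (r.brk e = .u ∧ e.1 = v) := by
    intro e he
    obtain ⟨h1, h2, -⟩ := h.1.2.1 e he
    cases hb : r.brk e with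
    | o => exact absurd hb (Finset.filter_eq_empty_iff.1 (Finset.card_eq_zero.1 hO) he)
    | u => exact Or.inr ⟨rfl, (hiff _).1 ⟨h1, h.mu_source he hb⟩⟩
    | s => exact Or.inl ⟨rfl, (hiff _).1 ⟨h2, h.mu_target he hb⟩⟩
  have hin : inDegAll r v = Scnt r := by
    unfold inDegAll Scnt
    congr 1
    refine Finset.filter_congr fun e he => ?_
    have hne := (h.1.2.1 e he).2.2
    rcases hbrk e he with ⟨hb, hev⟩ | ⟨hb, hev⟩
    · simp [hb, hev]
    · simp [hb, ← hev, hne.symm]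
  have hout : outDegAll r v = Ucnt r := by
    unfold outDegAll Ucnt
    congr 1
    refine Finset.filter_congr fun e he => ?_
    have hne := (h.1.2.1 e he).2.2
    rcases hbrk e he with ⟨hb, hev⟩ | ⟨hb, hev⟩
    · simp [hb, ← hev, hne]
    · simp [hb, hev]
  have hs1 : ∑ x ∈ r.nodes, ((r.lab x).s1 : ℤ) = (r.lab v).s1 :=
    Finset.sum_eq_single_of_mem v hvn fun x hx hxv => by
      simp [((h.2.1 x hx).1 (hint x hx hxv)).1]
  have hu2 : ∑ x ∈ r.nodes, ((r.lab x).u2 : ℤ) = (r.lab v).u2 :=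
    Finset.sum_eq_single_of_mem v hvn fun x hx hxv => by
      simp [((h.2.1 x hx).1 (hint x hx hxv)).2]
  obtain ⟨hls, hlu⟩ := hl
  rw [s1tot, hs1] at hls
  rw [u2tot, hu2] at hlu
  obtain ⟨ho1, ho2⟩ := (h.2.1 v hvn).2 hv1
  refine ⟨v, hvn, hv1, ⟨hvn, hv1, by omega, by omega⟩, fun x hx hxv => ⟨hint x hx hxv, ?_⟩⟩
  obtain ⟨y, hy | hy⟩ := h.1.exists_adjacent hx hvn hxv
  · rcases hbrk _ hy with ⟨-, rfl⟩ | ⟨-, rfl⟩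
    · exact Or.inl hy
    · exact absurd rfl hxv
  · rcases hbrk _ hy with ⟨-, rfl⟩ | ⟨-, rfl⟩
    · exact absurd rfl hxv
    · exact Or.inr hy

theorem RawAbs.IsDirTree.inDegAll_add_outDegAll_le {r : RawAbs} (h : r.IsDirTree) (v : ℕ) :
    inDegAll r v + outDegAll r v ≤ r.arrows.card := by
  unfold inDegAll outDegAll
  rw [← Finset.card_union_of_disjoint]
  · exact Finset.card_le_card
      (Finset.union_subset (Finset.filter_subset _ _) (Finset.filter_subset _ _))
  · rw [Finset.disjoint_filter]
    exact fun e he h2 h1 => (h.2.1 e he).2.2 (h1.trans h2.symm)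

theorem card_nodes_le_of_star {r : RawAbs} {v : ℕ}
    (hstar : ∀ x ∈ r.nodes, x ≠ v → (x, v) ∈ r.arrows ∨ (v, x) ∈ r.arrows) :
    r.nodes.card ≤ inDegAll r v + outDegAll r v + 1 := by
  have hsub : r.nodes.erase v ⊆ (r.arrows.filter fun e => e.2 = v).image Prod.fst ∪
      (r.arrows.filter fun e => e.1 = v).image Prod.snd := by
    intro x hx
    obtain ⟨hxv, hxn⟩ := Finset.mem_erase.1 hx
    simpa using hstar x hxn hxv
  have h1 := Finset.card_le_card hsub
  have h2 := Finset.card_union_le ((r.arrows.filter fun e => e.2 = v).image Prod.fst)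
    ((r.arrows.filter fun e => e.1 = v).image Prod.snd)
  have h3 := Finset.card_image_le (s := r.arrows.filter fun e => e.2 = v) (f := Prod.fst)
  have h4 := Finset.card_image_le (s := r.arrows.filter fun e => e.1 = v) (f := Prod.snd)
  have h5 := Finset.pred_card_le_card_erase (s := r.nodes) (a := v)
  unfold inDegAll outDegAll
  omega

theorem FormIa.weight_eq {r : RawAbs} (hf : FormIa r) : weight r = 2 := by
  obtain ⟨a, b, hab, hn, -, ha, hb, -⟩ := hf
  rw [weight, hn, Finset.sum_pair hab]
  simp [AbsEdge.w, ha, hb]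

theorem FormIb.weight_eq {r : RawAbs} (hf : FormIb r) (h : IsAbsPath r) : weight r = 2 := by
  obtain ⟨v, hv, hv1, ⟨-, -, hin, hout⟩, hstar⟩ := hf
  have hle := h.1.inDegAll_add_outDegAll_le v
  have hge := card_nodes_le_of_star fun x hx hxv => (hstar x hx hxv).2
  have hcard := h.1.card_arrows
  obtain ⟨ho1, ho2⟩ := (h.2.1 v hv).2 hv1
  have herase : ∑ x ∈ r.nodes.erase v, (r.lab x).w = (r.nodes.erase v).card := by
    rw [Finset.card_eq_sum_ones, Nat.cast_sum]
    refine Finset.sum_congr rfl fun x hx => ?_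
    obtain ⟨hxv, hxn⟩ := Finset.mem_erase.1 hx
    simp [AbsEdge.w, (hstar x hxn hxv).1]
  have hw : (r.lab v).w = 2 - (r.lab v).s1 - (r.lab v).u2 := by simp [AbsEdge.w, hv1]
  have hce := Finset.card_erase_add_one hv
  rw [weight, ← Finset.add_sum_erase _ _ hv, herase, hw]
  omega

/-- (i) A legal abstract path has weight 2 if and only if it has the form Ia
or the form Ib.  (ii) A boundary abstract path has length 2 if and only if it consists of two
boundary edges joined by a single break (the configuration of Move II). -/
theorem classification_weight_two (r : RawAbs) (h : IsAbsPath r) :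
    (Legal r → (weight r = 2 ↔ FormIa r ∨ FormIb r)) ∧
    ((∀ v ∈ r.nodes, (r.lab v).mu = 1) →
      (r.nodes.card = 2 ↔
        ∃ a b : ℕ, a ≠ b ∧ r.nodes = {a, b} ∧ r.arrows = {(a, b)})) := by
  refine ⟨fun hl => ⟨fun hw => ?_, ?_⟩, fun _ => ⟨h.1.exists_eq_pair, ?_⟩⟩
  · rw [hl.weight_eq h] at hw
    rcases (show Ocnt r = 1 ∧ Bcnt r = 0 ∨ Ocnt r = 0 ∧ Bcnt r = 1 by omega) with
      ⟨hO, hB⟩ | ⟨hO, hB⟩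
    · exact Or.inl (h.formIa hO hB)
    · exact Or.inr (h.formIb hl hO hB)
  · rintro (hf | hf)
    · exact hf.weight_eq
    · exact hf.weight_eq h
  · rintro ⟨a, b, hab, hn, -⟩
    rw [hn, Finset.card_pair hab]

end
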